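/- arXiv:1304.8102 — 3 statements merged into one kernel-verified Lean document; each statement's English description precedes it below -/
import Mathlib

section
/- Let n ∈ {1, 2} and let μ be any Borel probability measure on (0, ∞) (no bounded-support assumption). Let f be the SIRP noise density f(x) = ∫ (2πσ²)^{−n/2} exp(−‖x‖²/(2σ²)) dμ(σ). Then for any decoder with center-convex decision regions (each Ω_i measurable and star-shaped about the origin), the symbol error rate as a function of the signal power, P_e(p_s) = 1 − Σ_{i=1}^{M} q_i ∫_{√p_s • Ω_i} f(x) dx, is convex on (0, ∞). -/
open MeasureTheory Real Set Pointwise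

lemma concaveOn_setIntegral_Ioc_sqrt_mul {m : ℕ} (hm : m ≤ 1) {k : ℝ → ℝ}
    (hk0 : ∀ r, 0 < r → 0 ≤ k r) (hanti : AntitoneOn k (Ioi 0))
    (hki : IntegrableOn (fun r => r ^ m * k r) (Ioi 0)) {R : ℝ} (hR : 0 < R) :
    ConcaveOn ℝ (Ioi 0) (fun p => ∫ r in Ioc 0 (√p * R), r ^ m * k r) := by
  have hii : ∀ a b : ℝ, 0 ≤ a → 0 ≤ b →
      IntervalIntegrable (fun r => r ^ m * k r) volume a b := fun a b ha hb =>
    ⟨hki.mono_set fun x hx => ha.trans_lt hx.1, hki.mono_set fun x hx => hb.trans_lt hx.1⟩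
  have hdiff : ∀ x y : ℝ, (∫ r in Ioc 0 (√y * R), r ^ m * k r) -
      (∫ r in Ioc 0 (√x * R), r ^ m * k r) = ∫ r in (√x * R)..(√y * R), r ^ m * k r := by
    intro x y
    rw [← intervalIntegral.integral_of_le (by positivity),
      ← intervalIntegral.integral_of_le (by positivity),
      intervalIntegral.integral_interval_sub_left] <;> exact hii _ _ (by positivity) (by positivity)
  have hpow : ∀ x y c : ℝ, 0 < x → 0 < y → ∫ r in (√x * R)..(√y * R), r ^ m * c =
      c * R ^ (m + 1) / (m + 1) * (y ^ ((m + 1 : ℝ) / 2) - x ^ ((m + 1 : ℝ) / 2)) := by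
    intro x y c hx hy
    have h : ∀ z : ℝ, 0 < z → z ^ ((m + 1 : ℝ) / 2) = √z ^ (m + 1) := by
      intro z hz
      rw [Real.sqrt_eq_rpow, ← Real.rpow_natCast, ← Real.rpow_mul hz.le]
      push_cast
      ring_nf
    rw [intervalIntegral.integral_mul_const, integral_pow, h x hx, h y hy]
    ring
  have hconc : ConcaveOn ℝ (Ici 0) fun x : ℝ => x ^ ((m + 1 : ℝ) / 2) := by
    apply Real.concaveOn_rpow (by positivity)
    have : (m : ℝ) ≤ 1 := by exact_mod_cast hm
    linarith
  refine concaveOn_of_slope_anti_adjacent (convex_Ioi 0) ?_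
  intro x y z hx hz hxy hyz
  have hx : 0 < x := hx
  have hy : 0 < y := hx.trans hxy
  have hz : 0 < z := hz
  set c := k (√y * R)
  have hyR : 0 < √y * R := by positivity
  have hsxy : √x * R ≤ √y * R := by gcongr
  have hsyz : √y * R ≤ √z * R := by gcongr
  have hci : ∀ a b : ℝ, IntervalIntegrable (fun r => r ^ m * c) volume a b := fun a b =>
    (by fun_prop : Continuous fun r : ℝ => r ^ m * c).intervalIntegrable a b
  have h1 : (∫ r in (√x * R)..(√y * R), r ^ m * c) ≤
      ∫ r in (√x * R)..(√y * R), r ^ m * k r := by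
    refine intervalIntegral.integral_mono_on hsxy (hci _ _)
      (hii _ _ (by positivity) (by positivity)) fun r hr => ?_
    have hr0 : 0 < r := lt_of_lt_of_le (by positivity) hr.1
    exact mul_le_mul_of_nonneg_left (hanti hr0 hyR hr.2) (by positivity)
  have h2 : (∫ r in (√y * R)..(√z * R), r ^ m * k r) ≤
      ∫ r in (√y * R)..(√z * R), r ^ m * c := by
    refine intervalIntegral.integral_mono_on hsyz
      (hii _ _ (by positivity) (by positivity)) (hci _ _) fun r hr => ?_
    have hr0 : 0 < r := lt_of_lt_of_le (by positivity) hr.1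
    exact mul_le_mul_of_nonneg_left (hanti hyR hr0 hr.1) (by positivity)
  rw [hpow _ _ _ hx hy] at h1
  rw [hpow _ _ _ hy hz] at h2
  have hc0 : 0 ≤ c := hk0 _ hyR
  simp only [hdiff]
  calc _ ≤ (c * R ^ (m + 1) / (m + 1) * (z ^ ((m + 1 : ℝ) / 2) - y ^ ((m + 1 : ℝ) / 2)))
        / (z - y) := by gcongr
    _ ≤ (c * R ^ (m + 1) / (m + 1) * (y ^ ((m + 1 : ℝ) / 2) - x ^ ((m + 1 : ℝ) / 2)))
        / (y - x) := by
      rw [mul_div_assoc (c * R ^ (m + 1) / (m + 1)), mul_div_assoc (c * R ^ (m + 1) / (m + 1))]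
      exact mul_le_mul_of_nonneg_left
        (hconc.slope_anti_adjacent (mem_Ici.2 hx.le) (mem_Ici.2 hz.le) hxy hyz) (by positivity)
    _ ≤ _ := by gcongr

lemma concaveOn_integral_indicator_div_sqrt {m : ℕ} (hm : m ≤ 1) {k : ℝ → ℝ}
    (hk0 : ∀ r, 0 < r → 0 ≤ k r) (hanti : AntitoneOn k (Ioi 0))
    (hki : IntegrableOn (fun r => r ^ m * k r) (Ioi 0)) {A : Set ℝ}
    (hA : ∀ r ∈ A, ∀ s, 0 < s → s ≤ r → s ∈ A) :
    ConcaveOn ℝ (Ioi 0) (fun p => ∫ r in Ioi 0,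
      {r | r / √p ∈ A}.indicator (fun r => r ^ m * k r) r) := by
  by_cases hne : (A ∩ Ioi 0).Nonempty
  swap
  · refine (concaveOn_const (0 : ℝ) (convex_Ioi 0)).congr fun p hp => ?_
    have hp : 0 < p := hp
    refine (setIntegral_eq_zero_of_forall_eq_zero fun r hr => ?_).symm
    have hr : 0 < r := hr
    exact indicator_of_notMem (show r ∉ {r | r / √p ∈ A} from
      fun h => hne ⟨_, h, div_pos hr (Real.sqrt_pos.2 hp)⟩) _
  by_cases hb : BddAbove (A ∩ Ioi 0)
  swap
  · refine (concaveOn_const (∫ r in Ioi 0, r ^ m * k r) (convex_Ioi 0)).congr fun p hp => ?_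
    have hp : 0 < p := hp
    refine setIntegral_congr_fun measurableSet_Ioi fun r hr => ?_
    have hr : 0 < r := hr
    rw [not_bddAbove_iff] at hb
    obtain ⟨s, hs, hrs⟩ := hb (r / √p)
    exact (indicator_of_mem (show r ∈ {r | r / √p ∈ A} from
      hA s hs.1 _ (by positivity) hrs.le) fun r => r ^ m * k r).symm
  set R := sSup (A ∩ Ioi 0)
  have hR : 0 < R := by
    obtain ⟨s, hs⟩ := hne
    exact lt_of_lt_of_le hs.2 (le_csSup hb hs)
  refine (concaveOn_setIntegral_Ioc_sqrt_mul hm hk0 hanti hki hR).congr fun p hp => ?_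
  have hp : 0 < p := hp
  have hsp : 0 < √p := by positivity
  dsimp only
  rw [← inter_eq_self_of_subset_right (Ioc_subset_Ioi_self : Ioc 0 (√p * R) ⊆ Ioi 0),
    ← setIntegral_indicator measurableSet_Ioc]
  refine setIntegral_congr_ae measurableSet_Ioi ?_
  filter_upwards [Measure.ae_ne volume (√p * R)] with r hrR hr
  have hr : 0 < r := hr
  by_cases h : r < √p * R
  · rw [indicator_of_mem (show r ∈ Ioc 0 (√p * R) from ⟨hr, h.le⟩), indicator_of_mem]
    have h' : r / √p < R := by rwa [div_lt_iff₀' hsp]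
    obtain ⟨s, hs, hrs⟩ := exists_lt_of_lt_csSup hne h'
    exact hA s hs.1 _ (by positivity) hrs.le
  · rw [indicator_of_notMem (fun h' => h (lt_of_le_of_ne h'.2 hrR)), indicator_of_notMem]
    intro h'
    have := le_csSup hb (show r / √p ∈ A ∩ Ioi 0 from ⟨h', div_pos hr hsp⟩)
    rw [div_le_iff₀' hsp] at this
    exact h (lt_of_le_of_ne this hrR)

/-- Integration in polar coordinates. -/
lemma integral_polar {E F : Type*} [NormedAddCommGroup E] [NormedSpace ℝ E]
    [FiniteDimensional ℝ E] [MeasurableSpace E] [BorelSpace E] [Nontrivial E]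
    [NormedAddCommGroup F] [NormedSpace ℝ F] (μ : Measure E) [μ.IsAddHaarMeasure]
    {f : E → F} (hf : Integrable f μ) :
    Integrable (fun θ : Metric.sphere (0 : E) 1 =>
      ∫ r in Ioi (0 : ℝ), r ^ (Module.finrank ℝ E - 1) • f (r • (θ : E))) μ.toSphere ∧
    ∫ x, f x ∂μ = ∫ θ : Metric.sphere (0 : E) 1,
      (∫ r in Ioi (0 : ℝ), r ^ (Module.finrank ℝ E - 1) • f (r • (θ : E))) ∂μ.toSphere := by
  set d := Module.finrank ℝ E
  let g : Metric.sphere (0 : E) 1 × Ioi (0 : ℝ) → F := fun z => f ((z.2 : ℝ) • (z.1 : E))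
  have hg : ∀ x : ({0}ᶜ : Set E), g (homeomorphUnitSphereProd E x) = f x := by
    intro x
    have hx : ‖(x : E)‖ ≠ 0 := norm_ne_zero_iff.2 x.2
    simp [g, smul_smul, hx]
  have hmp := μ.measurePreserving_homeomorphUnitSphereProd
  have hemb := (homeomorphUnitSphereProd E).measurableEmbedding
  have hin : ∀ θ : Metric.sphere (0 : E) 1, ∫ r, g (θ, r) ∂Measure.volumeIoiPow (d - 1) =
      ∫ r in Ioi (0 : ℝ), r ^ (d - 1) • f (r • (θ : E)) := by
    intro θ
    simp only [Measure.volumeIoiPow, ENNReal.ofReal, g]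
    rw [integral_withDensity_eq_integral_smul,
      integral_subtype_comap measurableSet_Ioi fun a =>
        Real.toNNReal (a ^ (d - 1)) • f (a • (θ : E)),
      setIntegral_congr_fun measurableSet_Ioi fun x hx => ?_]
    · have hx : 0 < x := hx
      simp only [NNReal.smul_def, Real.coe_toNNReal _ (pow_nonneg hx.le _)]
    · exact (measurable_subtype_coe.pow_const _).real_toNNReal
  have hgi : Integrable g (μ.toSphere.prod (Measure.volumeIoiPow (d - 1))) := by
    rw [← hmp.integrable_comp_emb hemb]
    have : g ∘ homeomorphUnitSphereProd E = f ∘ ((↑) : ({0}ᶜ : Set E) → E) := funext hg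
    rw [this, ← integrableOn_iff_comap_subtypeVal (measurableSet_singleton _).compl]
    exact hf.integrableOn
  simp only [← hin]
  refine ⟨hgi.integral_prod_left, ?_⟩
  rw [← integral_prod g hgi, ← hmp.integral_comp hemb]
  simp only [hg]
  rw [integral_subtype_comap (measurableSet_singleton _).compl f,
    restrict_compl_singleton]

lemma concaveOn_setIntegral_sqrt_smul {E : Type*} [NormedAddCommGroup E] [NormedSpace ℝ E]
    [FiniteDimensional ℝ E] [MeasurableSpace E] [BorelSpace E] [Nontrivial E]
    (μ : Measure E) [μ.IsAddHaarMeasure] (hE : Module.finrank ℝ E ≤ 2) {k : ℝ → ℝ}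
    (hk0 : ∀ r, 0 < r → 0 ≤ k r) (hanti : AntitoneOn k (Ioi 0))
    (hki : Integrable (fun x : E => k ‖x‖) μ) {Ω : Set E} (hΩ : MeasurableSet Ω)
    (hstar : StarConvex ℝ 0 Ω) :
    ConcaveOn ℝ (Ioi 0) (fun p => ∫ x in √p • Ω, k ‖x‖ ∂μ) := by
  have hpol := fun p (hp : p ∈ Ioi (0 : ℝ)) => integral_polar μ (hki.indicator
    (hΩ.const_smul_of_ne_zero (Real.sqrt_ne_zero'.2 hp)))
  set Φ : Metric.sphere (0 : E) 1 → ℝ → ℝ := fun θ p =>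
    ∫ r in Ioi (0 : ℝ), r ^ (Module.finrank ℝ E - 1) •
      (√p • Ω).indicator (fun x => k ‖x‖) (r • (θ : E))
  have hconc : ∀ θ, ConcaveOn ℝ (Ioi 0) (Φ θ) := by
    intro θ
    refine (concaveOn_integral_indicator_div_sqrt (m := Module.finrank ℝ E - 1) (by omega)
      hk0 hanti ((integrable_fun_norm_addHaar μ).1 hki) (A := {s | s • (θ : E) ∈ Ω}) ?_).congr ?_
    · intro r hr s hs hsr
      have h := hstar.smul_mem hr (div_nonneg hs.le (hs.le.trans hsr))
        (div_le_one_of_le₀ hsr (hs.le.trans hsr))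
      rwa [smul_smul, div_mul_cancel₀ _ (hs.trans_le hsr).ne'] at h
    · intro p hp
      have hp : 0 < p := hp
      refine setIntegral_congr_fun measurableSet_Ioi fun r hr => ?_
      have hr : 0 < r := hr
      have hiff : r • (θ : E) ∈ √p • Ω ↔ r / √p ∈ {s | s • (θ : E) ∈ Ω} := by
        rw [mem_smul_set_iff_inv_smul_mem₀ (by positivity), smul_smul, mem_ofPred_eq,
          div_eq_inv_mul]
      by_cases h : r • (θ : E) ∈ √p • Ω
      · rw [indicator_of_mem (show r ∈ {r | r / √p ∈ {s | s • (θ : E) ∈ Ω}} from hiff.1 h)]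
        simp [indicator_of_mem h, norm_smul, abs_of_pos hr]
      · rw [indicator_of_notMem (show r ∉ {r | r / √p ∈ {s | s • (θ : E) ∈ Ω}} from
          fun h' => h (hiff.2 h'))]
        simp [indicator_of_notMem h]
  have hΦi : ∀ p ∈ Ioi (0 : ℝ), Integrable (fun θ => Φ θ p) μ.toSphere :=
    fun p hp => (hpol p hp).1
  have hconc' : ConcaveOn ℝ (Ioi 0) fun p => ∫ θ, Φ θ p ∂μ.toSphere := by
    refine ⟨convex_Ioi 0, fun x hx y hy a b ha hb hab => ?_⟩
    have hxy := convex_Ioi (0 : ℝ) hx hy ha hb hab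
    have hadd := integral_add ((hΦi x hx).smul a) ((hΦi y hy).smul b)
    simp only [Pi.smul_apply] at hadd
    simp only [← integral_smul]
    rw [← hadd]
    exact integral_mono (((hΦi x hx).smul a).add ((hΦi y hy).smul b)) (hΦi _ hxy)
      fun θ => (hconc θ).2 hx hy ha hb hab
  refine hconc'.congr fun p hp => ?_
  rw [← integral_indicator (hΩ.const_smul_of_ne_zero (Real.sqrt_ne_zero'.2 hp))]
  exact (hpol p hp).2.symm

/-- The density at radius `r` of the centered isotropic Gaussian on `ℝⁿ` with scale `σ`. -/
noncomputable def gaussianRadial (n : ℕ) (σ r : ℝ) : ℝ :=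
  (2 * π * σ ^ 2) ^ (-(n : ℝ) / 2) * Real.exp (-r ^ 2 / (2 * σ ^ 2))

lemma gaussianRadial_nonneg (n : ℕ) (σ r : ℝ) : 0 ≤ gaussianRadial n σ r := by
  unfold gaussianRadial
  positivity

lemma measurable_gaussianRadial (n : ℕ) : Measurable fun z : ℝ × ℝ => gaussianRadial n z.2 z.1 := by
  unfold gaussianRadial
  fun_prop

lemma gaussianRadial_anti (n : ℕ) (σ : ℝ) {r s : ℝ} (hr : 0 ≤ r) (hrs : r ≤ s) :
    gaussianRadial n σ s ≤ gaussianRadial n σ r := by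
  unfold gaussianRadial
  gcongr

lemma gaussianRadial_le {n : ℕ} (hn : n ≤ 2) (σ : ℝ) {r : ℝ} (hr : 0 < r) :
    gaussianRadial n σ r ≤ 1 + (r ^ 2 * π)⁻¹ := by
  unfold gaussianRadial
  set v := (2 * π * σ ^ 2)⁻¹ with hv
  have hv0 : 0 ≤ v := by positivity
  have h1 : (2 * π * σ ^ 2) ^ (-(n : ℝ) / 2) = v ^ ((n : ℝ) / 2) := by
    rw [neg_div, Real.rpow_neg (by positivity), hv, Real.inv_rpow (by positivity)]
  have h2 : -r ^ 2 / (2 * σ ^ 2) = -(r ^ 2 * π * v) := by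
    rw [hv]
    rcases eq_or_ne σ 0 with rfl | h
    · simp
    · field_simp
  have hn' : (n : ℝ) ≤ 2 := by exact_mod_cast hn
  have h3 : v ^ ((n : ℝ) / 2) ≤ 1 + v := by
    rcases le_total v 1 with h | h
    · linarith [Real.rpow_le_one hv0 h (by positivity : (0 : ℝ) ≤ n / 2)]
    · have := Real.rpow_le_rpow_of_exponent_le h (by linarith : (n : ℝ) / 2 ≤ 1)
      rw [Real.rpow_one] at this
      linarith
  have hc : 0 < r ^ 2 * π := by positivity
  set c := r ^ 2 * π
  have hcv : 0 ≤ c * v := by positivity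
  have h4 : v * Real.exp (-(c * v)) ≤ c⁻¹ := by
    rw [Real.exp_neg, ← div_eq_mul_inv, div_le_iff₀ (Real.exp_pos _), inv_mul_eq_div,
      le_div_iff₀ hc]
    linarith [Real.add_one_le_exp (c * v)]
  have h5 : Real.exp (-(c * v)) ≤ 1 := Real.exp_le_one_iff.2 (by linarith)
  rw [h1, h2]
  calc _ ≤ (1 + v) * Real.exp (-(c * v)) := by gcongr
    _ = Real.exp (-(c * v)) + v * Real.exp (-(c * v)) := by ring
    _ ≤ _ := add_le_add h5 h4

lemma integrable_gaussianRadial_scale {n : ℕ} (hn : n ≤ 2) (μ : Measure ℝ) [IsFiniteMeasure μ]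
    {r : ℝ} (hr : 0 < r) : Integrable (fun σ => gaussianRadial n σ r) μ := by
  refine Integrable.of_bound (C := 1 + (r ^ 2 * π)⁻¹)
    ((measurable_gaussianRadial n).comp measurable_prodMk_left).aestronglyMeasurable
    (ae_of_all _ fun σ => ?_)
  rw [Real.norm_of_nonneg (gaussianRadial_nonneg _ _ _)]
  exact gaussianRadial_le hn σ hr

lemma integrable_gaussianRadial_norm (n : ℕ) {σ : ℝ} (hσ : 0 < σ) :
    Integrable (fun x : EuclideanSpace ℝ (Fin n) => gaussianRadial n σ ‖x‖) ∧
      ∫ x : EuclideanSpace ℝ (Fin n), gaussianRadial n σ ‖x‖ = 1 := by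
  have hb : 0 < (2 * σ ^ 2)⁻¹ := by positivity
  have hI : ∫ x : EuclideanSpace ℝ (Fin n), gaussianRadial n σ ‖x‖ = 1 := by
    have h := GaussianFourier.integral_rexp_neg_mul_sq_norm (V := EuclideanSpace ℝ (Fin n)) hb
    have he : ∀ x : EuclideanSpace ℝ (Fin n), gaussianRadial n σ ‖x‖ =
        (2 * π * σ ^ 2) ^ (-(n : ℝ) / 2) * Real.exp (-(2 * σ ^ 2)⁻¹ * ‖x‖ ^ 2) := by
      intro x
      unfold gaussianRadial
      congr 2
      ring
    simp only [he]
    rw [integral_const_mul, h, finrank_euclideanSpace_fin, neg_div, Real.rpow_neg (by positivity),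
      show π / (2 * σ ^ 2)⁻¹ = 2 * π * σ ^ 2 by field_simp]
    exact inv_mul_cancel₀ (by positivity)
  exact ⟨.of_integral_ne_zero (by simp [hI]), hI⟩

lemma integrable_integral_gaussianRadial (n : ℕ) (μ : Measure ℝ) [IsFiniteMeasure μ]
    (hμ : ∀ᵐ σ ∂μ, 0 < σ) :
    Integrable fun x : EuclideanSpace ℝ (Fin n) => ∫ σ, gaussianRadial n σ ‖x‖ ∂μ := by
  have hm : AEStronglyMeasurable
      (fun z : EuclideanSpace ℝ (Fin n) × ℝ => gaussianRadial n z.2 ‖z.1‖) (volume.prod μ) :=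
    ((measurable_gaussianRadial n).comp
      (measurable_fst.norm.prodMk measurable_snd)).aestronglyMeasurable
  refine Integrable.integral_prod_left
    (f := fun z : EuclideanSpace ℝ (Fin n) × ℝ => gaussianRadial n z.2 ‖z.1‖)
    ((integrable_prod_iff' hm).2 ⟨?_, ?_⟩)
  · filter_upwards [hμ] with σ hσ using (integrable_gaussianRadial_norm n hσ).1
  · refine (integrable_const (1 : ℝ)).congr ?_
    filter_upwards [hμ] with σ hσ
    simp only [Real.norm_of_nonneg (gaussianRadial_nonneg _ _ _)]
    exact (integrable_gaussianRadial_norm n hσ).2.symm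

/-- In low dimensions (`n = 1` or `n = 2`), under SIRP noise with
arbitrary mixing distribution on `(0, ∞)`, the SER of any decoder with
center-convex decision regions is convex in the signal power on `(0, ∞)`. -/
theorem ser_always_convex_low_dim_sirp
    (n M : ℕ) (hn : n = 1 ∨ n = 2)
    (μ : Measure ℝ) [IsProbabilityMeasure μ]
    (hsupp : μ (Ioi (0 : ℝ))ᶜ = 0)
    (f : EuclideanSpace ℝ (Fin n) → ℝ)
    (hf : ∀ x, f x = ∫ σ,
      (2 * π * σ ^ 2) ^ (-(n : ℝ) / 2) * Real.exp (-‖x‖ ^ 2 / (2 * σ ^ 2)) ∂μ)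
    (q : Fin M → ℝ) (hq : ∀ i, 0 ≤ q i) (hqsum : ∑ i, q i = 1)
    (Ω : Fin M → Set (EuclideanSpace ℝ (Fin n)))
    (hΩmeas : ∀ i, MeasurableSet (Ω i))
    (hΩstar : ∀ i, StarConvex ℝ (0 : EuclideanSpace ℝ (Fin n)) (Ω i))
    (Pe : ℝ → ℝ)
    (hPe : ∀ ps, Pe ps = 1 - ∑ i, q i * ∫ x in Real.sqrt ps • Ω i, f x) :
    ConvexOn ℝ (Ioi (0 : ℝ)) Pe := by
  have hn2 : n ≤ 2 := by omega
  have : Nonempty (Fin n) := ⟨⟨0, by omega⟩⟩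
  have hpos : ∀ᵐ σ ∂μ, 0 < σ := hsupp
  obtain rfl : f = fun x => ∫ σ, gaussianRadial n σ ‖x‖ ∂μ := funext hf
  obtain rfl : Pe = _ := funext hPe
  have hconc : ∀ i, ConcaveOn ℝ (Ioi 0) fun ps => q i *
      ∫ x in √ps • Ω i, ∫ σ, gaussianRadial n σ ‖x‖ ∂μ := fun i =>
    (concaveOn_setIntegral_sqrt_smul volume (by simpa using hn2)
      (k := fun r => ∫ σ, gaussianRadial n σ r ∂μ)
      (fun r _ => integral_nonneg fun σ => gaussianRadial_nonneg n σ r)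
      (fun r hr s hs hrs => integral_mono (integrable_gaussianRadial_scale hn2 μ hs)
        (integrable_gaussianRadial_scale hn2 μ hr)
        fun σ => gaussianRadial_anti n σ (le_of_lt hr) hrs)
      (integrable_integral_gaussianRadial n μ hpos) (hΩmeas i) (hΩstar i)).smul (hq i)
  refine (convexOn_const (1 : ℝ) (convex_Ioi 0)).sub ?_
  refine ⟨convex_Ioi 0, fun x hx y hy a b ha hb hab => ?_⟩
  simp only [Finset.smul_sum]
  rw [← Finset.sum_add_distrib]
  exact Finset.sum_le_sum fun i _ => (hconc i).2 hx hy ha hb hab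
end

section
/- Let n ≥ 1, let 0 < σ₁ ≤ σ₂, and let μ be a Borel probability measure on ℝ supported in [σ₁, σ₂]. Define the SIRP noise density at SNR γ > 0 by f_γ(x) = ∫ (γ/(2πσ²))^{n/2} exp(−γ‖x‖²/(2σ²)) dμ(σ). Let Ω_1, …, Ω_K ⊆ E be Lebesgue-measurable sets each disjoint from the open ball of radius d_min > 0 centered at the origin, and let c_1, …, c_K ≥ 0. Then B(γ) = Σ_{k=1}^{K} c_k ∫_{Ω_k} f_γ(x) dx is convex on the set {γ : γ > 0 and γ·d_min² ≥ (n + √(2n))·σ₂²}. In particular, the PEP, SER and BER of any decoder whose decision-region boundaries are at distance at least d_min from the constellation points are convex in the SNR in this regime under SIRP noise. -/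
open MeasureTheory Real Set

/-- `γ ↦ γ ^ m * exp (-γ t)` is convex where `γ t` is at least `m + √m`, since there
`(γ t - m) ^ 2 ≥ m`. -/
lemma convexOn_rpow_mul_exp_neg {D : Set ℝ} (hD : Convex ℝ D) {m t : ℝ} (hm : 0 ≤ m)
    (hpos : ∀ γ ∈ D, 0 < γ) (hfar : ∀ γ ∈ D, m + √m ≤ γ * t) :
    ConvexOn ℝ D fun γ => γ ^ m * Real.exp (-γ * t) := by
  have hexp (γ : ℝ) : HasDerivAt (fun γ => Real.exp (-γ * t)) (Real.exp (-γ * t) * (-1 * t)) γ :=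
    (((hasDerivAt_id γ).neg).mul_const t).exp
  have hpow (p : ℝ) {γ : ℝ} (hγ : 0 < γ) :
      HasDerivAt (fun γ : ℝ => γ ^ p) (p * γ ^ (p - 1)) γ :=
    Real.hasDerivAt_rpow_const (Or.inl hγ.ne')
  have h₁ {γ : ℝ} (hγ : 0 < γ) := (hpow m hγ).mul (hexp γ)
  have h₂ {γ : ℝ} (hγ : 0 < γ) :=
    (((hpow (m - 1) hγ).const_mul m).mul (hexp γ)).add
      ((hpow m hγ).mul ((hexp γ).mul_const (-1 * t)))
  refine convexOn_of_hasDerivWithinAt2_nonneg hD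
    (fun γ hγ => (h₁ (hpos γ hγ)).continuousAt.continuousWithinAt)
    (fun γ hγ => (h₁ (hpos γ (interior_subset hγ))).hasDerivWithinAt)
    (fun γ hγ => (h₂ (hpos γ (interior_subset hγ))).hasDerivWithinAt) fun γ hγ => ?_
  have hγ₀ := hpos γ (interior_subset hγ)
  have hγt := hfar γ (interior_subset hγ)
  have e₁ : γ ^ (m - 1) = γ ^ (m - 1 - 1) * γ := by
    rw [← Real.rpow_add_one hγ₀.ne']; congr 1; ring
  have e₂ : γ ^ m = γ ^ (m - 1 - 1) * γ * γ := by
    rw [← Real.rpow_add_one hγ₀.ne', ← Real.rpow_add_one hγ₀.ne']; congr 1; ring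
  have key : 0 ≤ (γ * t - m) ^ 2 - m := by
    nlinarith [Real.sq_sqrt hm, Real.sqrt_nonneg m]
  have h := mul_nonneg (mul_nonneg (Real.rpow_nonneg hγ₀.le (m - 1 - 1))
    (Real.exp_pos (-γ * t)).le) key
  rw [e₂, e₁]
  linarith

/-- A Bochner integral of convex functions of a parameter is convex in the parameter. -/
lemma convexOn_integral {α E : Type*} [MeasurableSpace α] [AddCommMonoid E] [Module ℝ E]
    {ν : Measure α} {D : Set E} (hD : Convex ℝ D) {F : E → α → ℝ}
    (hint : ∀ γ ∈ D, Integrable (F γ) ν) (hconv : ∀ᵐ a ∂ν, ConvexOn ℝ D fun γ => F γ a) :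
    ConvexOn ℝ D fun γ => ∫ a, F γ a ∂ν := by
  refine ⟨hD, fun x hx y hy a b ha hb hab => ?_⟩
  have hx' := (hint x hx).const_mul a
  have hy' := (hint y hy).const_mul b
  simp only [smul_eq_mul]
  rw [← integral_const_mul, ← integral_const_mul, ← integral_add hx' hy']
  refine integral_mono_ae (hint _ (hD hx hy ha hb hab)) (hx'.add hy') ?_
  filter_upwards [hconv] with z hz using hz.2 hx hy ha hb hab

lemma convexOn_finset_sum {ι E : Type*} [AddCommMonoid E] [Module ℝ E] {D : Set E}
    (hD : Convex ℝ D) (s : Finset ι) {F : ι → E → ℝ} (hF : ∀ i ∈ s, ConvexOn ℝ D (F i)) :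
    ConvexOn ℝ D fun γ => ∑ i ∈ s, F i γ := by
  classical
  induction s using Finset.induction_on with
  | empty => simpa using convexOn_const (0 : ℝ) hD
  | insert i s hi ih =>
    simp only [Finset.sum_insert hi]
    exact (hF i (Finset.mem_insert_self i s)).add
      (ih fun j hj => hF j (Finset.mem_insert_of_mem hj))

lemma integrable_exp_neg_mul_sq_norm {ι : Type*} [Fintype ι] {b : ℝ} (hb : 0 < b) :
    Integrable fun x : EuclideanSpace ℝ ι => Real.exp (-b * ‖x‖ ^ 2) := by
  have h := (GaussianFourier.integrable_cexp_neg_mul_sq_norm_add_of_euclideanSpace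
    (ι := ι) (b := (b : ℂ)) (by simpa using hb) 0 0).norm
  refine h.congr (Filter.Eventually.of_forall fun x => ?_)
  simp [Complex.norm_exp, ← Complex.ofReal_pow]

/-- Bound on a centered Gaussian profile, uniform in the standard deviation. -/
lemma gaussian_profile_le {σ₁ σ₂ σ γ m r : ℝ} (hσ₁ : 0 < σ₁) (hσ : σ ∈ Icc σ₁ σ₂)
    (hγ : 0 < γ) (hm : 0 ≤ m) :
    (γ / (2 * π * σ ^ 2)) ^ m * Real.exp (-γ * r ^ 2 / (2 * σ ^ 2)) ≤
      (γ / (2 * π * σ₁ ^ 2)) ^ m * Real.exp (-(γ / (2 * σ₂ ^ 2)) * r ^ 2) := by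
  obtain ⟨h₁, h₂⟩ := hσ
  have hσ₀ : 0 < σ := hσ₁.trans_le h₁
  have hexp : -γ * r ^ 2 / (2 * σ ^ 2) ≤ -(γ / (2 * σ₂ ^ 2)) * r ^ 2 := by
    have : γ * r ^ 2 / (2 * σ₂ ^ 2) ≤ γ * r ^ 2 / (2 * σ ^ 2) := by gcongr
    calc _ = -(γ * r ^ 2 / (2 * σ ^ 2)) := by ring
      _ ≤ -(γ * r ^ 2 / (2 * σ₂ ^ 2)) := neg_le_neg this
      _ = _ := by ring
  gcongr

/-- Under SIRP noise with mixing distribution supported in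
`[σ₁, σ₂]`, any nonnegative combination (PEP, SER, BER) of probabilities of
regions at distance at least `d_min` from the transmitted point is convex in
the SNR on `{γ | 0 < γ ∧ (n + √(2n))σ₂² ≤ γ d_min²}`. -/
theorem ber_pep_convex_high_snr_sirp
    (n K : ℕ) (hn : 1 ≤ n)
    (σ₁ σ₂ : ℝ) (hσ₁ : 0 < σ₁) (hσ₁₂ : σ₁ ≤ σ₂)
    (μ : Measure ℝ) [IsProbabilityMeasure μ]
    (hsupp : μ (Icc σ₁ σ₂)ᶜ = 0)
    (f : ℝ → EuclideanSpace ℝ (Fin n) → ℝ)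
    (hf : ∀ γ x, f γ x = ∫ σ,
      (γ / (2 * π * σ ^ 2)) ^ ((n : ℝ) / 2) *
        Real.exp (-γ * ‖x‖ ^ 2 / (2 * σ ^ 2)) ∂μ)
    (dmin : ℝ) (hdmin : 0 < dmin)
    (Ω : Fin K → Set (EuclideanSpace ℝ (Fin n)))
    (hΩmeas : ∀ k, MeasurableSet (Ω k))
    (hΩfar : ∀ k, ∀ x ∈ Ω k, dmin ≤ ‖x‖)
    (c : Fin K → ℝ) (hc : ∀ k, 0 ≤ c k)
    (B : ℝ → ℝ)
    (hB : ∀ γ, B γ = ∑ k, c k * ∫ x in Ω k, f γ x) :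
    ConvexOn ℝ
      {γ : ℝ | 0 < γ ∧ ((n : ℝ) + Real.sqrt (2 * n)) * σ₂ ^ 2 ≤ γ * dmin ^ 2}
      B := by
  set D := {γ : ℝ | 0 < γ ∧ ((n : ℝ) + Real.sqrt (2 * n)) * σ₂ ^ 2 ≤ γ * dmin ^ 2}
  have hσ₂ : 0 < σ₂ := hσ₁.trans_le hσ₁₂
  have hm : (0 : ℝ) ≤ (n : ℝ) / 2 := by positivity
  have hD : Convex ℝ D := (convex_Ioi (0 : ℝ)).inter
    (convex_halfSpace_ge (LinearMap.mulRight ℝ (dmin ^ 2)).isLinear _)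
  have hμ : ∀ᵐ σ ∂μ, σ ∈ Icc σ₁ σ₂ := hsupp
  have hsqrt : √(2 * (n : ℝ)) = 2 * √((n : ℝ) / 2) := by
    rw [show 2 * (n : ℝ) = 2 ^ 2 * (n / 2) by ring, Real.sqrt_mul (by positivity),
      Real.sqrt_sq (by norm_num)]
  have hint (γ : ℝ) (hγ : 0 < γ) (x : EuclideanSpace ℝ (Fin n)) :
      Integrable (fun σ => (γ / (2 * π * σ ^ 2)) ^ ((n : ℝ) / 2) *
        Real.exp (-γ * ‖x‖ ^ 2 / (2 * σ ^ 2))) μ := by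
    refine (integrable_const ((γ / (2 * π * σ₁ ^ 2)) ^ ((n : ℝ) / 2) *
      Real.exp (-(γ / (2 * σ₂ ^ 2)) * ‖x‖ ^ 2))).mono'
      (Measurable.aestronglyMeasurable (by fun_prop)) ?_
    filter_upwards [hμ] with σ hσ
    rw [Real.norm_of_nonneg (by positivity)]
    exact gaussian_profile_le hσ₁ hσ hγ hm
  have hfint (γ : ℝ) (hγ : 0 < γ) : Integrable (f γ) := by
    have hmeas : AEStronglyMeasurable (f γ) := by
      rw [show f γ = _ from funext (hf γ)]
      exact (StronglyMeasurable.integral_prod_right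
        (Measurable.stronglyMeasurable (by fun_prop))).aestronglyMeasurable
    refine ((integrable_exp_neg_mul_sq_norm (b := γ / (2 * σ₂ ^ 2)) (by positivity)).const_mul
      ((γ / (2 * π * σ₁ ^ 2)) ^ ((n : ℝ) / 2))).mono' hmeas
      (Filter.Eventually.of_forall fun x => ?_)
    rw [hf, Real.norm_of_nonneg (integral_nonneg fun σ => by positivity)]
    refine (integral_mono_ae (hint γ hγ x) (integrable_const _)
      (hμ.mono fun σ hσ => gaussian_profile_le hσ₁ hσ hγ hm)).trans_eq ?_
    simp
  have hfconv (x : EuclideanSpace ℝ (Fin n)) (hx : dmin ≤ ‖x‖) :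
      ConvexOn ℝ D fun γ => f γ x := by
    simp only [hf]
    refine convexOn_integral hD (fun γ hγ => hint γ hγ.1 x) (hμ.mono fun σ hσ => ?_)
    have hσ₀ : 0 < σ := hσ₁.trans_le hσ.1
    have hfar : ∀ γ ∈ D, (n : ℝ) / 2 + √((n : ℝ) / 2) ≤ γ * (‖x‖ ^ 2 / (2 * σ ^ 2)) := by
      rintro γ ⟨hγ, h⟩
      rw [hsqrt] at h
      rw [← mul_div_assoc, le_div_iff₀ (by positivity)]
      calc ((n : ℝ) / 2 + √((n : ℝ) / 2)) * (2 * σ ^ 2)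
          = ((n : ℝ) + 2 * √((n : ℝ) / 2)) * σ ^ 2 := by ring
        _ ≤ ((n : ℝ) + 2 * √((n : ℝ) / 2)) * σ₂ ^ 2 := by
          gcongr
          exact hσ.2
        _ ≤ γ * dmin ^ 2 := h
        _ ≤ γ * ‖x‖ ^ 2 := by gcongr
    refine ((convexOn_rpow_mul_exp_neg hD hm (fun γ hγ => hγ.1) hfar).smul
      (c := ((2 * π * σ ^ 2) ^ ((n : ℝ) / 2))⁻¹) (by positivity)).congr fun γ hγ => ?_
    simp only [smul_eq_mul]
    rw [Real.div_rpow hγ.1.le (by positivity), ← mul_div_assoc]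
    ring
  rw [show B = _ from funext hB]
  refine convexOn_finset_sum hD _ fun k _ => ConvexOn.smul (hc k) ?_
  refine convexOn_integral hD (fun γ hγ => (hfint γ hγ.1).integrableOn) ?_
  filter_upwards [ae_restrict_mem (hΩmeas k)] with x hx using hfconv x (hΩfar k x hx)
end

section
/- Let n ≥ 1, let 0 < σ₁ ≤ σ₂, and let μ be a Borel probability measure on ℝ supported in [σ₁, σ₂]. Define the SIRP noise density at noise power v > 0 by f_v(x) = ∫ (2πvσ²)^{−n/2} exp(−‖x‖²/(2vσ²)) dμ(σ), and the symbol error rate P_e(v) = 1 − Σ_{i=1}^{M} q_i ∫_{Ω_i} f_v(x) dx. If Metric.closedBall 0 d_min ⊆ Ω_i for every i with d_min > 0, then P_e is convex on (0, d_min²/((n+2)σ₂²)]. If Ω_i ⊆ Metric.closedBall 0 d_max for every i with d_max > 0, then P_e is concave on [d_max²/((n+2)σ₁²), ∞). -/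
open MeasureTheory Real Set

/-- The gamma-type profile `t ^ m * exp (-t² / 2)` decreases when moving away from its
mode `t = √m`. -/
lemma pow_mul_exp_neg_sq_le {m : ℕ} {s t : ℝ} (hs : 0 < s) (ht : 0 < t)
    (h : (m - t ^ 2) * (s ^ 2 - t ^ 2) ≤ 0) :
    s ^ m * exp (-s ^ 2 / 2) ≤ t ^ m * exp (-t ^ 2 / 2) := by
  have hz : s / t ≤ exp (((s / t) ^ 2 - 1) / 2) := by
    have h1 := add_one_le_exp (s / t - 1)
    have h2 : exp (s / t - 1) ≤ exp (((s / t) ^ 2 - 1) / 2) :=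
      exp_le_exp.2 (by nlinarith [sq_nonneg (s / t - 1)])
    linarith
  have hzm : (s / t) ^ m ≤ exp (m * (((s / t) ^ 2 - 1) / 2)) := by
    rw [exp_nat_mul]
    exact pow_le_pow_left₀ (by positivity) hz m
  have hle : m * (((s / t) ^ 2 - 1) / 2) ≤ s ^ 2 / 2 - t ^ 2 / 2 := by
    have : m * (((s / t) ^ 2 - 1) / 2) - (s ^ 2 / 2 - t ^ 2 / 2) =
        (m - t ^ 2) * (s ^ 2 - t ^ 2) / (2 * t ^ 2) := by
      field_simp
    have h2 : (m - t ^ 2) * (s ^ 2 - t ^ 2) / (2 * t ^ 2) ≤ 0 :=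
      div_nonpos_of_nonpos_of_nonneg h (by positivity)
    linarith
  have hkey : s ^ m ≤ t ^ m * exp (s ^ 2 / 2 - t ^ 2 / 2) := by
    have := hzm.trans (exp_le_exp.2 hle)
    rw [div_pow, div_le_iff₀ (by positivity)] at this
    linarith
  calc s ^ m * exp (-s ^ 2 / 2)
      ≤ t ^ m * exp (s ^ 2 / 2 - t ^ 2 / 2) * exp (-s ^ 2 / 2) := by gcongr
    _ = t ^ m * exp (-t ^ 2 / 2) := by
      rw [mul_assoc, ← exp_add]
      congr 2
      ring

/-- The mass of the radial profile `s ^ k * exp (-s² / 2)` over `(0, R / √w)`. -/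
noncomputable def radialMass (k : ℕ) (R w : ℝ) : ℝ :=
  ∫ s in (0 : ℝ)..R / √w, s ^ k * exp (-s ^ 2 / 2)

lemma hasDerivAt_radialMass (k : ℕ) {R w : ℝ} (hR : 0 < R) (hw : 0 < w) :
    HasDerivAt (radialMass k R)
      (-((R / √w) ^ (k + 3) * exp (-(R / √w) ^ 2 / 2)) / (2 * R ^ 2)) w := by
  have hc : Continuous fun s : ℝ => s ^ k * exp (-s ^ 2 / 2) := by fun_prop
  have h1 := (hc.integral_hasStrictDerivAt 0 (R / √w)).hasDerivAt
  have hsq : √w ≠ 0 := (sqrt_pos.2 hw).ne'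
  have h2 : HasDerivAt (fun w => R / √w) (-(R * (1 / (2 * √w))) / √w ^ 2) w := by
    simpa using (hasDerivAt_const w R).fun_div (hasDerivAt_sqrt hw.ne') hsq
  refine (h1.comp w h2).congr_deriv ?_
  rw [pow_add (R / √w) k 3]
  field_simp

lemma radialMass_concaveOn (k : ℕ) {R : ℝ} (hR : 0 < R) :
    ConcaveOn ℝ (Ioc 0 (R ^ 2 / (k + 3))) (radialMass k R) := by
  refine AntitoneOn.concaveOn_of_deriv (convex_Ioc _ _)
    (fun w hw => (hasDerivAt_radialMass k hR hw.1).continuousAt.continuousWithinAt) ?_ ?_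
  · rw [interior_Ioc]
    exact fun w hw =>
      (hasDerivAt_radialMass k hR hw.1).differentiableAt.differentiableWithinAt
  · rw [interior_Ioc]
    intro w hw w' hw' hww
    have h0 : 0 < w := hw.1
    have h0' : 0 < w' := hw'.1
    rw [(hasDerivAt_radialMass k hR hw.1).deriv, (hasDerivAt_radialMass k hR hw'.1).deriv]
    gcongr ?_ / _
    refine neg_le_neg (pow_mul_exp_neg_sq_le (by positivity) (by positivity) ?_)
    simp only [div_pow, sq_sqrt h0.le, sq_sqrt h0'.le]
    have h1 : R ^ 2 / w' ≤ R ^ 2 / w := by gcongr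
    have h2 : (k : ℝ) + 3 ≤ R ^ 2 / w' := by
      have := hw'.2.le
      rw [le_div_iff₀ (by positivity)] at this ⊢
      linarith
    push_cast
    nlinarith

lemma radialMass_convexOn (k : ℕ) {R : ℝ} (hR : 0 < R) :
    ConvexOn ℝ (Ici (R ^ 2 / (k + 3))) (radialMass k R) := by
  have hpos : ∀ w ∈ Ici (R ^ 2 / (k + 3)), 0 < w := fun w hw =>
    lt_of_lt_of_le (by positivity) hw
  refine MonotoneOn.convexOn_of_deriv (convex_Ici _)
    (fun w hw => (hasDerivAt_radialMass k hR (hpos w hw)).continuousAt.continuousWithinAt)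
    (fun w hw => (hasDerivAt_radialMass k hR
      (hpos w (interior_subset hw))).differentiableAt.differentiableWithinAt) ?_
  intro w hw w' hw' hww
  have h0 := hpos w (interior_subset hw)
  have h0' := hpos w' (interior_subset hw')
  have hwR : R ^ 2 / (k + 3) ≤ w := interior_subset hw
  rw [(hasDerivAt_radialMass k hR h0).deriv, (hasDerivAt_radialMass k hR h0').deriv]
  gcongr ?_ / _
  refine neg_le_neg (pow_mul_exp_neg_sq_le (by positivity) (by positivity) ?_)
  simp only [div_pow, sq_sqrt h0.le, sq_sqrt h0'.le]
  have h1 : R ^ 2 / w' ≤ R ^ 2 / w := by gcongr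
  have h2 : R ^ 2 / w ≤ k + 3 := by
    rw [div_le_iff₀ (by positivity)] at hwR ⊢
    linarith
  push_cast
  nlinarith

/-- Integrating the radial profile over the dilate `(√w)⁻¹ • A` of a bounded initial segment `A`
of `(0, ∞)` gives the radial mass up to the endpoint `sSup A`. -/
lemma integral_indicator_sqrt_mul_eq_radialMass (k : ℕ) {A : Set ℝ}
    (hA : ∀ r ∈ A, ∀ s, 0 < s → s ≤ r → s ∈ A) (hb : BddAbove A) {w : ℝ} (hw : 0 < w)
    (hR : 0 ≤ sSup A) :
    ∫ s in Ioi (0 : ℝ), s ^ k * (A.indicator 1 (√w * s) * exp (-s ^ 2 / 2)) =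
      radialMass k (sSup A) w := by
  have hsq : 0 < √w := sqrt_pos.2 hw
  rw [radialMass, intervalIntegral.integral_of_le (by positivity), integral_Ioc_eq_integral_Ioo,
    ← integral_indicator measurableSet_Ioi, ← integral_indicator measurableSet_Ioo]
  refine integral_congr_ae ?_
  filter_upwards [compl_mem_ae_iff.2 (measure_singleton (sSup A / √w))] with s hs
  have hs' : s ≠ sSup A / √w := hs
  by_cases h0 : 0 < s
  · rcases lt_or_gt_of_ne hs' with hlt | hgt
    · have h1 : s * √w < sSup A := (lt_div_iff₀ hsq).1 hlt
      have hne : A.Nonempty := by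
        by_contra hne
        rw [not_nonempty_iff_eq_empty.1 hne, Real.sSup_empty] at h1
        nlinarith [mul_pos h0 hsq]
      obtain ⟨r, hr, hsr⟩ := exists_lt_of_lt_csSup hne h1
      have hmem : √w * s ∈ A := hA r hr _ (by positivity) (by linarith)
      simp [indicator, h0, hlt, hmem]
    · have hmem : √w * s ∉ A := fun hmem => by
        have := le_csSup hb hmem
        have := (div_lt_iff₀ hsq).1 hgt
        linarith
      simp [indicator, hmem, hgt.not_gt]
  · simp [indicator, h0]

lemma concaveOn_integral_indicator_sqrt_mul (k : ℕ) {A : Set ℝ}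
    (hA : ∀ r ∈ A, ∀ s, 0 < s → s ≤ r → s ∈ A) {d : ℝ} (hd : 0 < d) (hdA : d ∈ A) :
    ConcaveOn ℝ (Ioc 0 (d ^ 2 / (k + 3))) fun w : ℝ =>
      ∫ s in Ioi (0 : ℝ), s ^ k * (A.indicator 1 (√w * s) * exp (-s ^ 2 / 2)) := by
  by_cases hb : BddAbove A
  · have hdR : d ≤ sSup A := le_csSup hb hdA
    have hR : 0 < sSup A := hd.trans_le hdR
    refine ((radialMass_concaveOn k hR).subset (Ioc_subset_Ioc_right (by gcongr))
      (convex_Ioc _ _)).congr fun w hw => ?_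
    exact (integral_indicator_sqrt_mul_eq_radialMass k hA hb hw.1 hR.le).symm
  · refine (concaveOn_const (∫ s in Ioi (0 : ℝ), s ^ k * exp (-s ^ 2 / 2))
      (convex_Ioc _ _)).congr fun w hw => ?_
    refine setIntegral_congr_fun measurableSet_Ioi fun s hs => ?_
    obtain ⟨r, hr, hsr⟩ := not_bddAbove_iff.1 hb (√w * s)
    have hmem : √w * s ∈ A := hA r hr _ (mul_pos (sqrt_pos.2 hw.1) hs) hsr.le
    simp [hmem]

lemma convexOn_integral_indicator_sqrt_mul (k : ℕ) {A : Set ℝ}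
    (hA : ∀ r ∈ A, ∀ s, 0 < s → s ≤ r → s ∈ A) {d : ℝ} (hd : 0 < d)
    (hA0 : A ⊆ Ioc 0 d) :
    ConvexOn ℝ (Ici (d ^ 2 / (k + 3))) fun w : ℝ =>
      ∫ s in Ioi (0 : ℝ), s ^ k * (A.indicator 1 (√w * s) * exp (-s ^ 2 / 2)) := by
  rcases A.eq_empty_or_nonempty with rfl | ⟨r, hr⟩
  · simpa using convexOn_const (0 : ℝ) (convex_Ici _)
  have hb : BddAbove A := ⟨d, fun r hr => (hA0 hr).2⟩
  have hRd : sSup A ≤ d := csSup_le ⟨r, hr⟩ fun r hr => (hA0 hr).2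
  have hR : 0 < sSup A := (hA0 hr).1.trans_le (le_csSup hb hr)
  refine ((radialMass_convexOn k hR).subset (Ici_subset_Ici.2 (by gcongr))
    (convex_Ici _)).congr fun w hw => ?_
  have hw0 : 0 < w := lt_of_lt_of_le (by positivity) hw
  exact (integral_indicator_sqrt_mul_eq_radialMass k hA hb hw0 hR.le).symm

lemma integral_volumeIoiPow (k : ℕ) (g : ℝ → ℝ) :
    ∫ r : Ioi (0 : ℝ), g r ∂Measure.volumeIoiPow k = ∫ s in Ioi (0 : ℝ), s ^ k * g s := by
  simp only [Measure.volumeIoiPow, ENNReal.ofReal]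
  rw [integral_withDensity_eq_integral_smul,
    integral_subtype_comap measurableSet_Ioi fun a ↦ Real.toNNReal (a ^ k) • g a,
    setIntegral_congr_fun measurableSet_Ioi fun x hx ↦ ?_]
  · rw [NNReal.smul_def, Real.coe_toNNReal _ (pow_nonneg hx.out.le _), smul_eq_mul]
  · exact (measurable_subtype_coe.pow_const _).real_toNNReal

section Polar

variable {E : Type*} [NormedAddCommGroup E] [NormedSpace ℝ E]
  [FiniteDimensional ℝ E] [MeasurableSpace E] [BorelSpace E] (ν : Measure E)
  [ν.IsAddHaarMeasure]

lemma MeasureTheory.Integrable.comp_homeomorphUnitSphereProd_symm {f : E → ℝ}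
    (hf : Integrable f ν) :
    Integrable (fun p : Metric.sphere (0 : E) 1 × Ioi (0 : ℝ) => f (p.2.1 • p.1.1))
      (ν.toSphere.prod (.volumeIoiPow (Module.finrank ℝ E - 1))) := by
  rw [← ν.measurePreserving_homeomorphUnitSphereProd.integrable_comp_emb
    (Homeomorph.measurableEmbedding _)]
  have h : Integrable (fun x : ({0}ᶜ : Set E) => f x) (ν.comap (↑)) := by
    have := hf.integrableOn (s := ({0}ᶜ : Set E))
    rwa [integrableOn_iff_comap_subtypeVal (measurableSet_singleton _).compl] at this
  refine h.congr (.of_forall fun x => ?_)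
  have hx : ‖x.1‖ ≠ 0 := norm_ne_zero_iff.2 x.2
  simp [smul_smul, hx]

lemma MeasureTheory.Integrable.polar_integrable {f : E → ℝ} (hf : Integrable f ν) :
    Integrable (fun θ : Metric.sphere (0 : E) 1 =>
      ∫ s in Ioi (0 : ℝ), s ^ (Module.finrank ℝ E - 1) * f (s • θ.1)) ν.toSphere := by
  refine (hf.comp_homeomorphUnitSphereProd_symm ν).integral_prod_left.congr
    (.of_forall fun θ => ?_)
  exact integral_volumeIoiPow _ fun s => f (s • θ.1)

lemma MeasureTheory.Integrable.integral_eq_polar [Nontrivial E] {f : E → ℝ} (hf : Integrable f ν) :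
    ∫ x, f x ∂ν = ∫ θ : Metric.sphere (0 : E) 1,
      (∫ s in Ioi (0 : ℝ), s ^ (Module.finrank ℝ E - 1) * f (s • θ.1)) ∂ν.toSphere := by
  have h := integral_prod _ (hf.comp_homeomorphUnitSphereProd_symm ν)
  have hray : ∀ θ : Metric.sphere (0 : E) 1,
      ∫ r : Ioi (0 : ℝ), f (r.1 • θ.1) ∂Measure.volumeIoiPow (Module.finrank ℝ E - 1) =
        ∫ s in Ioi (0 : ℝ), s ^ (Module.finrank ℝ E - 1) * f (s • θ.1) :=
    fun θ => integral_volumeIoiPow _ fun s => f (s • θ.1)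
  simp only [hray] at h
  rw [← h, ← ν.measurePreserving_homeomorphUnitSphereProd.integral_comp
    (Homeomorph.measurableEmbedding _)]
  have h0 : ∫ x, f x ∂ν = ∫ x : ({0}ᶜ : Set E), f x ∂(ν.comap (↑)) := by
    rw [integral_subtype_comap (measurableSet_singleton _).compl f, restrict_compl_singleton]
  rw [h0]
  refine integral_congr_ae (.of_forall fun x => ?_)
  have hx : ‖x.1‖ ≠ 0 := norm_ne_zero_iff.2 x.2
  simp [smul_smul, hx]

end Polar

lemma integrable_exp_neg_mul_norm_sq (n : ℕ) {b : ℝ} (hb : 0 < b) :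
    Integrable fun x : EuclideanSpace ℝ (Fin n) => exp (-b * ‖x‖ ^ 2) := by
  refine Integrable.of_integral_ne_zero ?_
  rw [GaussianFourier.integral_rexp_neg_mul_sq_norm hb]
  positivity

/-- The unnormalized standard Gaussian mass of the dilate `(√w)⁻¹ • Ω`. -/
noncomputable def gaussianMass {n : ℕ} (Ω : Set (EuclideanSpace ℝ (Fin n))) (w : ℝ) : ℝ :=
  ∫ z, Ω.indicator 1 (√w • z) * exp (-‖z‖ ^ 2 / 2)

section Gaussian

variable {n : ℕ} {Ω : Set (EuclideanSpace ℝ (Fin n))}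

lemma integrable_indicator_mul_exp (hΩ : MeasurableSet Ω) (w : ℝ) :
    Integrable fun z => Ω.indicator (1 : EuclideanSpace ℝ (Fin n) → ℝ) (√w • z) *
      exp (-‖z‖ ^ 2 / 2) := by
  have h := integrable_exp_neg_mul_norm_sq n (b := 1 / 2) (by norm_num)
  have hm : Measurable fun z => Ω.indicator (1 : EuclideanSpace ℝ (Fin n) → ℝ) (√w • z) :=
    (measurable_one.indicator hΩ).comp (measurable_const_smul _)
  refine h.mono' (hm.mul (by fun_prop)).aestronglyMeasurable (.of_forall fun z => ?_)
  have he : -‖z‖ ^ 2 / 2 = -(1 / 2) * ‖z‖ ^ 2 := by ring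
  rw [he]
  by_cases hz : √w • z ∈ Ω <;> simp [hz, (exp_pos _).le]

lemma setIntegral_gaussian_eq (hΩ : MeasurableSet Ω) {w : ℝ} (hw : 0 < w) :
    ∫ x in Ω, (2 * π * w) ^ (-(n : ℝ) / 2) * exp (-‖x‖ ^ 2 / (2 * w)) =
      (2 * π) ^ (-(n : ℝ) / 2) * gaussianMass Ω w := by
  have hsq : 0 < √w := sqrt_pos.2 hw
  have h := Measure.integral_comp_smul volume
    (fun x => Ω.indicator (1 : EuclideanSpace ℝ (Fin n) → ℝ) x * exp (-‖x‖ ^ 2 / (2 * w))) √w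
  have hexp : ∀ z : EuclideanSpace ℝ (Fin n),
      -‖√w • z‖ ^ 2 / (2 * w) = -‖z‖ ^ 2 / 2 := fun z => by
    rw [norm_smul, mul_pow, norm_eq_abs, sq_abs, sq_sqrt hw.le]
    field_simp
  simp only [hexp] at h
  have hpow : (√w ^ n)⁻¹ = w ^ (-(n : ℝ) / 2) := by
    rw [sqrt_eq_rpow, ← rpow_natCast, ← rpow_mul hw.le, ← rpow_neg hw.le]
    congr 1
    ring
  rw [gaussianMass, h, integral_const_mul, finrank_euclideanSpace_fin,
    abs_of_pos (by positivity), hpow, mul_rpow (by positivity) hw.le, smul_eq_mul, mul_assoc,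
    ← integral_indicator hΩ]
  congr 3
  ext x
  by_cases hx : x ∈ Ω <;> simp [hx]

/-- The set of positive radii at which the ray through `θ` lies in `Ω`. -/
def raySlice (Ω : Set (EuclideanSpace ℝ (Fin n))) (θ : EuclideanSpace ℝ (Fin n)) : Set ℝ :=
  {r | 0 < r ∧ r • θ ∈ Ω}

lemma StarConvex.mem_raySlice_of_le (hs : StarConvex ℝ 0 Ω) {θ : EuclideanSpace ℝ (Fin n)} :
    ∀ r ∈ raySlice Ω θ, ∀ s, 0 < s → s ≤ r → s ∈ raySlice Ω θ := by
  rintro r ⟨hr, hrΩ⟩ s hs0 hsr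
  refine ⟨hs0, ?_⟩
  have := hs.smul_mem hrΩ (t := s / r) (by positivity) ((div_le_one hr).2 hsr)
  rwa [smul_smul, div_mul_cancel₀ _ hr.ne'] at this

lemma gaussianMass_eq_polar (hn : 1 ≤ n) (hΩ : MeasurableSet Ω) {w : ℝ} (hw : 0 < w) :
    Integrable (fun θ : Metric.sphere (0 : EuclideanSpace ℝ (Fin n)) 1 =>
      ∫ s in Ioi (0 : ℝ), s ^ (n - 1) *
        ((raySlice Ω θ).indicator 1 (√w * s) * exp (-s ^ 2 / 2))) volume.toSphere ∧
    gaussianMass Ω w = ∫ θ : Metric.sphere (0 : EuclideanSpace ℝ (Fin n)) 1,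
      (∫ s in Ioi (0 : ℝ), s ^ (n - 1) *
        ((raySlice Ω θ).indicator 1 (√w * s) * exp (-s ^ 2 / 2))) ∂volume.toSphere := by
  have : Nonempty (Fin n) := ⟨⟨0, hn⟩⟩
  have hint := integrable_indicator_mul_exp hΩ w
  have hslice : ∀ θ : Metric.sphere (0 : EuclideanSpace ℝ (Fin n)) 1,
      ∫ s in Ioi (0 : ℝ), s ^ (n - 1) *
        (Ω.indicator 1 (√w • s • θ.1) * exp (-‖s • θ.1‖ ^ 2 / 2)) =
      ∫ s in Ioi (0 : ℝ), s ^ (n - 1) *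
        ((raySlice Ω θ).indicator 1 (√w * s) * exp (-s ^ 2 / 2)) := fun θ => by
    refine setIntegral_congr_fun measurableSet_Ioi fun s hs => ?_
    have hpos : 0 < √w * s := mul_pos (sqrt_pos.2 hw) hs
    have hnorm : ‖s • θ.1‖ = s := by
      rw [norm_smul, norm_eq_of_mem_sphere, mul_one, norm_of_nonneg (le_of_lt hs)]
    simp only [hnorm, smul_smul]
    by_cases hmem : (√w * s) • θ.1 ∈ Ω <;> simp [raySlice, hmem, hpos]
  have h1 := hint.polar_integrable volume
  have h2 := hint.integral_eq_polar volume
  simp only [finrank_euclideanSpace_fin, hslice] at h1 h2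
  exact ⟨h1, h2⟩

lemma gaussianMass_concaveOn (hn : 1 ≤ n) (hΩ : MeasurableSet Ω) (hs : StarConvex ℝ 0 Ω)
    {d : ℝ} (hd : 0 < d) (hball : Metric.closedBall 0 d ⊆ Ω) :
    ConcaveOn ℝ (Ioc 0 (d ^ 2 / (n + 2))) (gaussianMass Ω) := by
  refine (integral_concaveOn_of_integrand_ae (convex_Ioc _ _) (.of_forall fun θ => ?_)
    fun w hw => (gaussianMass_eq_polar hn hΩ hw.1).1).congr
      fun w hw => (gaussianMass_eq_polar hn hΩ hw.1).2.symm
  have hcast : (n : ℝ) + 2 = (n - 1 : ℕ) + 3 := by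
    push_cast [hn]
    ring
  rw [hcast]
  exact concaveOn_integral_indicator_sqrt_mul _ hs.mem_raySlice_of_le hd
    ⟨hd, hball (by simp [norm_smul, abs_of_pos hd])⟩

lemma gaussianMass_convexOn (hn : 1 ≤ n) (hΩ : MeasurableSet Ω) (hs : StarConvex ℝ 0 Ω)
    {d : ℝ} (hd : 0 < d) (hball : Ω ⊆ Metric.closedBall 0 d) :
    ConvexOn ℝ (Ici (d ^ 2 / (n + 2))) (gaussianMass Ω) := by
  have hpos : ∀ w ∈ Ici (d ^ 2 / ((n : ℝ) + 2)), 0 < w := fun w hw =>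
    lt_of_lt_of_le (by positivity) hw
  refine (integral_convexOn_of_integrand_ae (convex_Ici _) (.of_forall fun θ => ?_)
    fun w hw => (gaussianMass_eq_polar hn hΩ (hpos w hw)).1).congr
      fun w hw => (gaussianMass_eq_polar hn hΩ (hpos w hw)).2.symm
  have hcast : (n : ℝ) + 2 = (n - 1 : ℕ) + 3 := by
    push_cast [hn]
    ring
  rw [hcast]
  refine convexOn_integral_indicator_sqrt_mul _ hs.mem_raySlice_of_le hd
    fun r hr => ⟨hr.1, ?_⟩
  simpa [norm_smul, abs_of_pos hr.1] using hball hr.2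

end Gaussian

section Mixture

variable {n : ℕ} {Ω : Set (EuclideanSpace ℝ (Fin n))} {σ₁ σ₂ : ℝ} {μ : Measure ℝ}
  [IsProbabilityMeasure μ]

lemma integrable_prod_gaussian_density (hσ₁ : 0 < σ₁) (hμ : ∀ᵐ σ ∂μ, σ ∈ Icc σ₁ σ₂)
    (hσ₂ : 0 < σ₂) {v : ℝ} (hv : 0 < v) :
    Integrable (fun p : ℝ × EuclideanSpace ℝ (Fin n) =>
      (2 * π * v * p.1 ^ 2) ^ (-(n : ℝ) / 2) * exp (-‖p.2‖ ^ 2 / (2 * v * p.1 ^ 2)))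
      (μ.prod (volume.restrict Ω)) := by
  have hdom : Integrable (fun p : ℝ × EuclideanSpace ℝ (Fin n) =>
      (2 * π * v * σ₁ ^ 2) ^ (-(n : ℝ) / 2) * exp (-(1 / (2 * v * σ₂ ^ 2)) * ‖p.2‖ ^ 2))
      (μ.prod (volume.restrict Ω)) :=
    (((integrable_exp_neg_mul_norm_sq n (b := 1 / (2 * v * σ₂ ^ 2))
      (by positivity)).integrableOn (s := Ω)).comp_snd μ).const_mul _
  refine hdom.mono' (by fun_prop) ?_
  have hfst : ∀ᵐ p ∂μ.prod (volume.restrict Ω), p.1 ∈ Icc σ₁ σ₂ :=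
    Measure.quasiMeasurePreserving_fst.ae hμ
  filter_upwards [hfst] with p hp
  have hp0 : 0 < p.1 := hσ₁.trans_le hp.1
  have hp1 := hp.1
  have hp2 := hp.2
  rw [norm_of_nonneg (by positivity)]
  gcongr ?_ * exp ?_
  · exact rpow_le_rpow_of_nonpos (by positivity) (by gcongr)
      (div_nonpos_of_nonpos_of_nonneg (by simp) (by norm_num))
  · rw [neg_div, neg_mul, neg_le_neg_iff, one_div_mul_eq_div]
    gcongr

lemma setIntegral_sirp_density (hΩ : MeasurableSet Ω) (hσ₁ : 0 < σ₁) (hσ₂ : 0 < σ₂)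
    (hμ : ∀ᵐ σ ∂μ, σ ∈ Icc σ₁ σ₂) {v : ℝ} (hv : 0 < v) :
    Integrable (fun σ => (2 * π) ^ (-(n : ℝ) / 2) * gaussianMass Ω (v * σ ^ 2)) μ ∧
    ∫ x in Ω, ∫ σ, (2 * π * v * σ ^ 2) ^ (-(n : ℝ) / 2) *
        exp (-‖x‖ ^ 2 / (2 * v * σ ^ 2)) ∂μ =
      ∫ σ, (2 * π) ^ (-(n : ℝ) / 2) * gaussianMass Ω (v * σ ^ 2) ∂μ := by
  have hint := integrable_prod_gaussian_density (n := n) (Ω := Ω) hσ₁ hμ hσ₂ hv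
  have hae : (fun σ => ∫ x in Ω, (2 * π * v * σ ^ 2) ^ (-(n : ℝ) / 2) *
        exp (-‖x‖ ^ 2 / (2 * v * σ ^ 2))) =ᵐ[μ]
      fun σ => (2 * π) ^ (-(n : ℝ) / 2) * gaussianMass Ω (v * σ ^ 2) := by
    filter_upwards [hμ] with σ hσ
    have hσ0 : 0 < σ := hσ₁.trans_le hσ.1
    simpa only [mul_assoc] using
      setIntegral_gaussian_eq hΩ (w := v * σ ^ 2) (by positivity)
  refine ⟨hint.integral_prod_left.congr hae, ?_⟩
  rw [← integral_congr_ae hae]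
  exact (integral_integral_swap hint).symm

lemma sirp_mass_concaveOn (hn : 1 ≤ n) (hΩ : MeasurableSet Ω) (hs : StarConvex ℝ 0 Ω)
    (hσ₁ : 0 < σ₁) (hσ₂ : 0 < σ₂) (hμ : ∀ᵐ σ ∂μ, σ ∈ Icc σ₁ σ₂) {d : ℝ} (hd : 0 < d)
    (hball : Metric.closedBall 0 d ⊆ Ω) :
    ConcaveOn ℝ (Ioc 0 (d ^ 2 / ((n + 2) * σ₂ ^ 2))) fun v =>
      ∫ x in Ω, ∫ σ, (2 * π * v * σ ^ 2) ^ (-(n : ℝ) / 2) *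
        exp (-‖x‖ ^ 2 / (2 * v * σ ^ 2)) ∂μ := by
  refine (integral_concaveOn_of_integrand_ae (convex_Ioc _ _) ?_
    fun v hv => (setIntegral_sirp_density hΩ hσ₁ hσ₂ hμ hv.1).1).congr
      fun v hv => (setIntegral_sirp_density hΩ hσ₁ hσ₂ hμ hv.1).2.symm
  filter_upwards [hμ] with σ hσ
  have hσ0 : 0 < σ := hσ₁.trans_le hσ.1
  refine ((((gaussianMass_concaveOn hn hΩ hs hd hball).comp_linearMap
    (LinearMap.mulRight ℝ (σ ^ 2))).smul
      (c := (2 * π) ^ (-(n : ℝ) / 2)) (by positivity)).subset ?_ (convex_Ioc _ _))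
  rintro v ⟨hv0, hv⟩
  refine ⟨by simpa using by positivity, ?_⟩
  have hσ2 := hσ.2
  calc v * σ ^ 2 ≤ v * σ₂ ^ 2 := by gcongr
    _ ≤ d ^ 2 / ((n + 2) * σ₂ ^ 2) * σ₂ ^ 2 := by gcongr
    _ = d ^ 2 / (n + 2) := by field_simp

lemma sirp_mass_convexOn (hn : 1 ≤ n) (hΩ : MeasurableSet Ω) (hs : StarConvex ℝ 0 Ω)
    (hσ₁ : 0 < σ₁) (hσ₂ : 0 < σ₂) (hμ : ∀ᵐ σ ∂μ, σ ∈ Icc σ₁ σ₂) {d : ℝ} (hd : 0 < d)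
    (hball : Ω ⊆ Metric.closedBall 0 d) :
    ConvexOn ℝ (Ici (d ^ 2 / ((n + 2) * σ₁ ^ 2))) fun v =>
      ∫ x in Ω, ∫ σ, (2 * π * v * σ ^ 2) ^ (-(n : ℝ) / 2) *
        exp (-‖x‖ ^ 2 / (2 * v * σ ^ 2)) ∂μ := by
  have hpos : ∀ v ∈ Ici (d ^ 2 / (((n : ℝ) + 2) * σ₁ ^ 2)), 0 < v := fun v hv =>
    lt_of_lt_of_le (by positivity) hv
  refine (integral_convexOn_of_integrand_ae (convex_Ici _) ?_
    fun v hv => (setIntegral_sirp_density hΩ hσ₁ hσ₂ hμ (hpos v hv)).1).congr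
      fun v hv => (setIntegral_sirp_density hΩ hσ₁ hσ₂ hμ (hpos v hv)).2.symm
  filter_upwards [hμ] with σ hσ
  refine ((((gaussianMass_convexOn hn hΩ hs hd hball).comp_linearMap
    (LinearMap.mulRight ℝ (σ ^ 2))).smul
      (c := (2 * π) ^ (-(n : ℝ) / 2)) (by positivity)).subset ?_ (convex_Ici _))
  intro v hv
  have hv0 := hpos v hv
  have hσ1 := hσ.1
  calc d ^ 2 / ((n : ℝ) + 2) = d ^ 2 / ((n + 2) * σ₁ ^ 2) * σ₁ ^ 2 := by field_simp
    _ ≤ v * σ₁ ^ 2 := by gcongr; exact hv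
    _ ≤ v * σ ^ 2 := by gcongr

end Mixture

lemma ConvexOn.finset_sum {ι : Type*} (t : Finset ι) {s : Set ℝ} (hs : Convex ℝ s)
    {g : ι → ℝ → ℝ} (hg : ∀ i ∈ t, ConvexOn ℝ s (g i)) :
    ConvexOn ℝ s fun v => ∑ i ∈ t, g i v := by
  classical
  induction t using Finset.induction_on with
  | empty => simpa using convexOn_const (0 : ℝ) hs
  | insert a t ha ih =>
    simp only [Finset.sum_insert ha]
    exact (hg a (Finset.mem_insert_self a t)).add
      (ih fun i hi => hg i (Finset.mem_insert_of_mem hi))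


/-- Under SIRP noise with mixing distribution supported in
`[σ₁, σ₂]`, the SER of a decoder with center-convex decision regions, as a
function of the noise power `v`, is convex on `(0, d_min²/((n+2)σ₂²)]` and
concave on `[d_max²/((n+2)σ₁²), ∞)`. -/
theorem ser_convexity_in_noise_power_sirp
    (n M : ℕ) (hn : 1 ≤ n)
    (σ₁ σ₂ : ℝ) (hσ₁ : 0 < σ₁) (hσ₁₂ : σ₁ ≤ σ₂)
    (μ : Measure ℝ) [IsProbabilityMeasure μ]
    (hsupp : μ (Icc σ₁ σ₂)ᶜ = 0)
    (f : ℝ → EuclideanSpace ℝ (Fin n) → ℝ)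
    (hf : ∀ v x, f v x = ∫ σ,
      (2 * π * v * σ ^ 2) ^ (-(n : ℝ) / 2) *
        Real.exp (-‖x‖ ^ 2 / (2 * v * σ ^ 2)) ∂μ)
    (q : Fin M → ℝ) (hq : ∀ i, 0 ≤ q i) (hqsum : ∑ i, q i = 1)
    (Ω : Fin M → Set (EuclideanSpace ℝ (Fin n)))
    (hΩmeas : ∀ i, MeasurableSet (Ω i))
    (hΩstar : ∀ i, StarConvex ℝ (0 : EuclideanSpace ℝ (Fin n)) (Ω i))
    (Pe : ℝ → ℝ)
    (hPe : ∀ v, Pe v = 1 - ∑ i, q i * ∫ x in Ω i, f v x) :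
    (∀ dmin : ℝ, 0 < dmin →
      (∀ i, Metric.closedBall (0 : EuclideanSpace ℝ (Fin n)) dmin ⊆ Ω i) →
      ConvexOn ℝ (Ioc (0 : ℝ) (dmin ^ 2 / (((n : ℝ) + 2) * σ₂ ^ 2))) Pe) ∧
    (∀ dmax : ℝ, 0 < dmax →
      (∀ i, Ω i ⊆ Metric.closedBall (0 : EuclideanSpace ℝ (Fin n)) dmax) →
      ConcaveOn ℝ (Ici (dmax ^ 2 / (((n : ℝ) + 2) * σ₁ ^ 2))) Pe) := by
  have hσ₂ : 0 < σ₂ := hσ₁.trans_le hσ₁₂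
  have hμ : ∀ᵐ σ ∂μ, σ ∈ Icc σ₁ σ₂ := hsupp
  have hPe' : Pe = fun v => 1 - ∑ i, q i * ∫ x in Ω i, ∫ σ,
      (2 * π * v * σ ^ 2) ^ (-(n : ℝ) / 2) * exp (-‖x‖ ^ 2 / (2 * v * σ ^ 2)) ∂μ := by
    funext v
    simp only [hPe, hf]
  rw [hPe']
  refine ⟨fun d hd hball => ?_, fun d hd hball => ?_⟩
  · refine (convexOn_const 1 (convex_Ioc _ _)).sub (neg_convexOn_iff.1 ?_)
    refine (ConvexOn.finset_sum Finset.univ (convex_Ioc _ _) fun i _ =>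
      ((sirp_mass_concaveOn hn (hΩmeas i) (hΩstar i) hσ₁ hσ₂ hμ hd (hball i)).smul
        (hq i)).neg).congr fun v _ => ?_
    simp
  · exact (concaveOn_const 1 (convex_Ici _)).sub
      (ConvexOn.finset_sum Finset.univ (convex_Ici _) fun i _ =>
        (sirp_mass_convexOn hn (hΩmeas i) (hΩstar i) hσ₁ hσ₂ hμ hd (hball i)).smul (hq i))
end
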